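/- Let F_C ⊆ ℝ^d be an inhomogeneous self-similar set with the notation s, α, β as given. If max(α,β) < s then the upper box dimension of F_C is strictly less than s, and if max(α,β) < d then the upper box dimension of F_C is strictly less than d. -/

import Mathlib

/-- The number of cubes from the `δ`-mesh on `ℝ^d` (products of half-open intervals
`[aδ, (a+1)δ)`, `a ∈ ℤ`) that intersect `E`. -/
noncomputable def meshCount (d : ℕ) (δ : ℝ) (E : Set (Fin d → ℝ)) : ℕ :=
  Set.ncard {a : Fin d → ℤ | ∃ x ∈ E, ∀ i, (a i : ℝ) * δ ≤ x i ∧ x i < ((a i : ℝ) + 1) * δ}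

/-- The upper box dimension of `E ⊆ ℝ^d`. -/
noncomputable def upperBoxDim (d : ℕ) (E : Set (Fin d → ℝ)) : ℝ :=
  Filter.limsup (fun δ : ℝ => Real.log (meshCount d δ E) / (-Real.log δ))
    (nhdsWithin 0 (Set.Ioi 0))

/-- The Euclidean distance on `ℝ^d` (realised as `Fin d → ℝ`). -/
noncomputable def euclDist (d : ℕ) (x y : Fin d → ℝ) : ℝ :=
  Real.sqrt (∑ i, (x i - y i) ^ 2)

/-- `E` is covered by at most `n` closed sup-norm balls of radius `η`. -/
def CoveredBy (d : ℕ) (η n : ℝ) (E : Set (Fin d → ℝ)) : Prop :=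
  ∃ P : Finset (Fin d → ℝ), (P.card : ℝ) ≤ n ∧ ∀ y ∈ E, ∃ x ∈ P, dist y x ≤ η

/-- The index of the `δ`-mesh cube containing `x`. -/
noncomputable def meshIndex (d : ℕ) (δ : ℝ) (x : Fin d → ℝ) : Fin d → ℤ := fun i => ⌊x i / δ⌋

lemma meshCount_eq_ncard_image (d : ℕ) {δ : ℝ} (hδ : 0 < δ) (E : Set (Fin d → ℝ)) :
    meshCount d δ E = (meshIndex d δ '' E).ncard := by
  unfold meshCount
  congr 1
  ext a
  simp only [Set.mem_ofPred_eq, Set.mem_image, meshIndex, funext_iff, Int.floor_eq_iff,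
    le_div_iff₀ hδ, div_lt_iff₀ hδ]

lemma CoveredBy.mono {d : ℕ} {η n n' : ℝ} {E E' : Set (Fin d → ℝ)} (h : CoveredBy d η n E)
    (hn : n ≤ n') (hE : E' ⊆ E) : CoveredBy d η n' E' := by
  obtain ⟨P, hP, hc⟩ := h
  exact ⟨P, hP.trans hn, fun y hy => hc y (hE hy)⟩

lemma coveredBy_empty {d : ℕ} {η n : ℝ} (hn : 0 ≤ n) : CoveredBy d η n ∅ :=
  ⟨∅, by simpa using hn, by simp⟩

lemma CoveredBy.union {d : ℕ} {η n n' : ℝ} {E E' : Set (Fin d → ℝ)} (h : CoveredBy d η n E)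
    (h' : CoveredBy d η n' E') : CoveredBy d η (n + n') (E ∪ E') := by
  classical
  obtain ⟨P, hP, hc⟩ := h
  obtain ⟨Q, hQ, hc'⟩ := h'
  refine ⟨P ∪ Q, ?_, ?_⟩
  · have : ((P ∪ Q).card : ℝ) ≤ P.card + Q.card := by exact_mod_cast Finset.card_union_le P Q
    linarith
  · rintro y (hy | hy)
    · obtain ⟨x, hx, h⟩ := hc y hy
      exact ⟨x, Finset.mem_union_left _ hx, h⟩
    · obtain ⟨x, hx, h⟩ := hc' y hy
      exact ⟨x, Finset.mem_union_right _ hx, h⟩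

lemma coveredBy_iUnion {d : ℕ} {ι : Type*} [Fintype ι] {η : ℝ} {n : ι → ℝ}
    {E : ι → Set (Fin d → ℝ)} (h : ∀ i, CoveredBy d η (n i) (E i)) :
    CoveredBy d η (∑ i, n i) (⋃ i, E i) := by
  classical
  choose P hP hc using h
  refine ⟨Finset.univ.biUnion P, ?_, ?_⟩
  · have : ((Finset.univ.biUnion P).card : ℝ) ≤ ∑ i, ((P i).card : ℝ) := by
      exact_mod_cast Finset.card_biUnion_le
    exact this.trans (Finset.sum_le_sum fun i _ => hP i)
  · intro y hy
    obtain ⟨i, hi⟩ := Set.mem_iUnion.1 hy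
    obtain ⟨x, hx, h⟩ := hc i y hi
    exact ⟨x, Finset.mem_biUnion.2 ⟨i, Finset.mem_univ _, hx⟩, h⟩

lemma dist_le_euclDist (d : ℕ) (x y : Fin d → ℝ) : dist x y ≤ euclDist d x y := by
  refine (dist_pi_le_iff (Real.sqrt_nonneg _)).2 fun i => ?_
  rw [Real.dist_eq]
  refine Real.abs_le_sqrt ?_
  exact Finset.single_le_sum (f := fun i => (x i - y i) ^ 2) (fun j _ => sq_nonneg _)
    (Finset.mem_univ i)

lemma euclDist_le_mul_dist (d : ℕ) (x y : Fin d → ℝ) : euclDist d x y ≤ d * dist x y := by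
  refine Real.sqrt_le_iff.2 ⟨by positivity, ?_⟩
  have h1 : ∑ i, (x i - y i) ^ 2 ≤ ∑ _i : Fin d, dist x y ^ 2 := by
    refine Finset.sum_le_sum fun i _ => ?_
    have h := dist_le_pi_dist x y i
    rw [Real.dist_eq] at h
    rw [← sq_abs]
    gcongr
  have h2 : (d : ℝ) ≤ (d : ℝ) ^ 2 := by exact_mod_cast Nat.le_self_pow two_ne_zero d
  simp only [Finset.sum_const, Finset.card_univ, Fintype.card_fin, nsmul_eq_mul] at h1
  calc _ ≤ (d : ℝ) * dist x y ^ 2 := h1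
    _ ≤ (d : ℝ) ^ 2 * dist x y ^ 2 := by gcongr
    _ = _ := by ring

lemma CoveredBy.image {d : ℕ} {η n l : ℝ} {E : Set (Fin d → ℝ)} (h : CoveredBy d η n E)
    (hl : 0 ≤ l) {f : (Fin d → ℝ) → (Fin d → ℝ)}
    (hf : ∀ x y, euclDist d (f x) (f y) = l * euclDist d x y) :
    CoveredBy d (d * (l * η)) n (f '' E) := by
  classical
  obtain ⟨P, hP, hc⟩ := h
  refine ⟨P.image f, le_trans (by exact_mod_cast Finset.card_image_le) hP, ?_⟩
  rintro _ ⟨y, hy, rfl⟩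
  obtain ⟨x, hx, h⟩ := hc y hy
  refine ⟨f x, Finset.mem_image_of_mem f hx, ?_⟩
  calc dist (f y) (f x) ≤ l * euclDist d y x := (dist_le_euclDist _ _ _).trans_eq (hf y x)
    _ ≤ l * (d * η) := by
      gcongr
      exact (euclDist_le_mul_dist _ _ _).trans (by gcongr)
    _ = _ := by ring

lemma meshIndex_image_subset {d : ℕ} {δ : ℝ} (hδ : 0 < δ) {L : ℕ} {E : Set (Fin d → ℝ)}
    {P : Finset (Fin d → ℝ)} (h : ∀ y ∈ E, ∃ x ∈ P, dist y x ≤ L * δ) :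
    meshIndex d δ '' E ⊆ (P.biUnion fun x => Fintype.piFinset fun i =>
      Finset.Icc (meshIndex d δ x i - (L + 1)) (meshIndex d δ x i + (L + 1)) :
        Finset (Fin d → ℤ)) := by
  rintro _ ⟨y, hy, rfl⟩
  obtain ⟨x, hx, h⟩ := h y hy
  simp only [Finset.coe_biUnion, Set.mem_iUnion]
  refine ⟨x, hx, ?_⟩
  simp only [Finset.mem_coe, Fintype.mem_piFinset, Finset.mem_Icc, meshIndex]
  intro i
  have h1 := (dist_le_pi_dist y x i).trans h
  rw [Real.dist_eq, abs_le] at h1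
  have e1 : x i / δ ≤ y i / δ + L := by
    rw [div_add' _ _ _ hδ.ne']; gcongr; linarith
  have e2 : y i / δ ≤ x i / δ + L := by
    rw [div_add' _ _ _ hδ.ne']; gcongr; linarith
  have f1 := Int.floor_le_floor e1
  have f2 := Int.floor_le_floor e2
  rw [Int.floor_add_natCast] at f1 f2
  constructor <;> linarith

lemma CoveredBy.meshCount_le {d : ℕ} {δ n : ℝ} (hδ : 0 < δ) {L : ℕ} {E : Set (Fin d → ℝ)}
    (h : CoveredBy d (L * δ) n E) : (meshCount d δ E : ℝ) ≤ n * (2 * L + 3) ^ d := by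
  obtain ⟨P, hP, hc⟩ := h
  rw [meshCount_eq_ncard_image d hδ]
  have h1 := Set.ncard_le_ncard (meshIndex_image_subset hδ hc) (Finset.finite_toSet _)
  rw [Set.ncard_coe_finset] at h1
  have h2 := h1.trans (Finset.card_biUnion_le_card_mul P _ ((2 * L + 3) ^ d) fun x _ => by
    rw [Fintype.card_piFinset]
    simp only [Int.card_Icc]
    refine le_of_eq ?_
    rw [Finset.prod_congr rfl (g := fun _ => 2 * L + 3) fun i _ => by omega]
    simp)
  calc _ ≤ (P.card : ℝ) * (2 * L + 3) ^ d := by exact_mod_cast h2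
    _ ≤ _ := by gcongr

lemma meshCount_union_le (d : ℕ) {δ : ℝ} (hδ : 0 < δ) (E E' : Set (Fin d → ℝ)) :
    meshCount d δ (E ∪ E') ≤ meshCount d δ E + meshCount d δ E' := by
  simp only [meshCount_eq_ncard_image d hδ, Set.image_union]
  exact Set.ncard_union_le _ _

lemma exists_coveredBy_one {d : ℕ} {E : Set (Fin d → ℝ)} (hE : Bornology.IsBounded E) :
    ∃ R : ℕ, CoveredBy d R 1 E := by
  obtain ⟨R, hR⟩ := hE.subset_closedBall 0
  obtain ⟨N, hN⟩ := exists_nat_ge R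
  exact ⟨N, {0}, by simp, fun y hy => ⟨0, by simp, (Metric.mem_closedBall.1 (hR hy)).trans hN⟩⟩

lemma CoveredBy.rescale {d : ℕ} {η n δ : ℝ} {E : Set (Fin d → ℝ)} (hδ : 0 < δ)
    (h : CoveredBy d η n E) : CoveredBy d (⌈η / δ⌉₊ * δ) n E := by
  obtain ⟨P, hP, hc⟩ := h
  refine ⟨P, hP, fun y hy => ?_⟩
  obtain ⟨x, hx, h⟩ := hc y hy
  exact ⟨x, hx, h.trans ((div_le_iff₀ hδ).1 (Nat.le_ceil _))⟩

/-- Passing from a cover at scale `R ρ` to the mesh at a smaller scale `δ`. -/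
lemma CoveredBy.meshCount_le_of_le {d R : ℕ} {δ ρ n : ℝ} (hδ : 0 < δ) (hρ : δ ≤ ρ) (hn : 0 ≤ n)
    {E : Set (Fin d → ℝ)} (h : CoveredBy d (R * ρ) n E) :
    (meshCount d δ E : ℝ) ≤ n * ((2 * R + 5) * (ρ / δ)) ^ d := by
  refine ((h.rescale hδ).meshCount_le hδ).trans ?_
  have h1 : 1 ≤ ρ / δ := (one_le_div hδ).2 hρ
  have h2 : (⌈R * ρ / δ⌉₊ : ℝ) < R * ρ / δ + 1 :=
    Nat.ceil_lt_add_one (by have := hδ.trans_le hρ; positivity)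
  gcongr
  rw [mul_div_assoc] at h2
  rw [mul_div_assoc]
  linarith

lemma coveredBy_meshCount {d : ℕ} {δ : ℝ} (hδ : 0 < δ) {E : Set (Fin d → ℝ)}
    (hE : Bornology.IsBounded E) : CoveredBy d δ (meshCount d δ E) E := by
  classical
  obtain ⟨R, hR⟩ := exists_coveredBy_one hE
  obtain ⟨P, -, hc⟩ := hR.rescale hδ
  have hfin : (meshIndex d δ '' E).Finite :=
    (Finset.finite_toSet _).subset (meshIndex_image_subset hδ hc)
  have hrep : ∀ a ∈ meshIndex d δ '' E, ∃ x ∈ E, meshIndex d δ x = a := fun a ha => ha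
  choose! g hgE hg using hrep
  refine ⟨hfin.toFinset.image g, ?_, fun y hy => ?_⟩
  · rw [meshCount_eq_ncard_image d hδ, Set.ncard_eq_toFinset_card _ hfin]
    exact_mod_cast Finset.card_image_le
  · refine ⟨g (meshIndex d δ y), Finset.mem_image_of_mem _
      (hfin.mem_toFinset.2 (Set.mem_image_of_mem _ hy)), ?_⟩
    refine (dist_pi_le_iff hδ.le).2 fun i => ?_
    have h1 := congrFun (hg _ (Set.mem_image_of_mem _ hy)) i
    have h2 := (Int.abs_sub_lt_one_of_floor_eq_floor h1).le
    rw [← sub_div, abs_div, abs_of_pos hδ, div_le_one hδ] at h2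
    rwa [dist_comm, Real.dist_eq]

open Filter Topology

lemma eventually_log_meshCount_div_le {d : ℕ} {E : Set (Fin d → ℝ)} {K γ γ' : ℝ}
    (hγ : γ < γ') (hγ0 : 0 ≤ γ')
    (h : ∀ᶠ δ in 𝓝[>] (0 : ℝ), (meshCount d δ E : ℝ) ≤ K * δ ^ (-γ)) :
    ∀ᶠ δ in 𝓝[>] (0 : ℝ), Real.log (meshCount d δ E) / (-Real.log δ) ≤ γ' := by
  have h0 : Tendsto (fun δ : ℝ => K * δ ^ (γ' - γ)) (𝓝[>] 0) (𝓝 0) := by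
    have := ((Real.continuousAt_rpow_const 0 (γ' - γ) (Or.inr (by linarith))).tendsto.const_mul
      K).mono_left (nhdsWithin_le_nhds (s := Set.Ioi 0))
    rwa [Real.zero_rpow (by linarith), mul_zero] at this
  filter_upwards [h, h0.eventually (gt_mem_nhds one_pos), self_mem_nhdsWithin,
    nhdsWithin_le_nhds (gt_mem_nhds one_pos)] with δ h1 h2 h3 h4
  have hδ : (0 : ℝ) < δ := h3
  have hlog : 0 < -Real.log δ := neg_pos.2 (Real.log_neg hδ h4)
  rw [div_le_iff₀ hlog]
  have hle : (meshCount d δ E : ℝ) ≤ δ ^ (-γ') := by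
    calc _ ≤ K * δ ^ (-γ) := h1
      _ = (K * δ ^ (γ' - γ)) * δ ^ (-γ') := by
        rw [mul_assoc, ← Real.rpow_add hδ]; ring_nf
      _ ≤ 1 * δ ^ (-γ') := by gcongr
      _ = _ := one_mul _
  rcases Nat.eq_zero_or_pos (meshCount d δ E) with h0 | h0
  · rw [h0, Nat.cast_zero, Real.log_zero]
    positivity
  · have := Real.log_le_log (by exact_mod_cast h0) hle
    rw [Real.log_rpow hδ] at this
    linarith

lemma eventually_log_meshCount_div_nonneg (d : ℕ) (E : Set (Fin d → ℝ)) :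
    ∀ᶠ δ in 𝓝[>] (0 : ℝ), 0 ≤ Real.log (meshCount d δ E) / (-Real.log δ) := by
  filter_upwards [self_mem_nhdsWithin, nhdsWithin_le_nhds (gt_mem_nhds one_pos)] with δ h3 h4
  exact div_nonneg (Real.log_natCast_nonneg _) (neg_pos.2 (Real.log_neg h3 h4)).le

lemma isBoundedUnder_log_meshCount_div {d : ℕ} {E : Set (Fin d → ℝ)}
    (hE : Bornology.IsBounded E) :
    (𝓝[>] (0 : ℝ)).IsBoundedUnder (· ≤ ·)
      fun δ : ℝ => Real.log (meshCount d δ E) / (-Real.log δ) := by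
  obtain ⟨R, hR⟩ := exists_coveredBy_one hE
  refine ⟨d + 1, eventually_map.2 (eventually_log_meshCount_div_le (K := (2 * R + 5) ^ d)
    (lt_add_one (d : ℝ)) (by positivity) ?_)⟩
  filter_upwards [self_mem_nhdsWithin, nhdsWithin_le_nhds (gt_mem_nhds one_pos)] with δ h3 h4
  have h3 : (0 : ℝ) < δ := h3
  rw [← mul_one (R : ℝ)] at hR
  refine (hR.meshCount_le_of_le h3 h4.le zero_le_one).trans_eq ?_
  rw [one_mul, mul_pow, Real.rpow_neg h3.le, Real.rpow_natCast, one_div, inv_pow]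

lemma upperBoxDim_nonneg {d : ℕ} {E : Set (Fin d → ℝ)} (hE : Bornology.IsBounded E) :
    0 ≤ upperBoxDim d E :=
  le_limsup_of_frequently_le (eventually_log_meshCount_div_nonneg d E).frequently
    (isBoundedUnder_log_meshCount_div hE)

lemma upperBoxDim_lt {d : ℕ} {E : Set (Fin d → ℝ)} {K γ γ' : ℝ} (hγ : γ < γ') (hγ0 : 0 < γ')
    (h : ∀ᶠ δ in 𝓝[>] (0 : ℝ), (meshCount d δ E : ℝ) ≤ K * δ ^ (-γ)) :
    upperBoxDim d E < γ' := by
  obtain ⟨g, hg, hg'⟩ := exists_between (max_lt hγ hγ0)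
  refine lt_of_le_of_lt (limsup_le_of_le ?_ (eventually_log_meshCount_div_le
    ((le_max_left _ _).trans_lt hg) ((le_max_right _ _).trans hg.le) h)) hg'
  exact IsBoundedUnder.isCoboundedUnder_le
    ⟨0, eventually_map.2 (eventually_log_meshCount_div_nonneg d E)⟩

lemma eventually_coveredBy_of_upperBoxDim_lt {d : ℕ} {E : Set (Fin d → ℝ)} {γ : ℝ}
    (hE : Bornology.IsBounded E) (h : upperBoxDim d E < γ) :
    ∀ᶠ δ in 𝓝[>] (0 : ℝ), CoveredBy d δ (δ ^ (-γ)) E := by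
  filter_upwards [eventually_lt_of_limsup_lt h (isBoundedUnder_log_meshCount_div hE),
    self_mem_nhdsWithin, nhdsWithin_le_nhds (gt_mem_nhds one_pos)] with δ h1 h3 h4
  have hδ : (0 : ℝ) < δ := h3
  refine (coveredBy_meshCount hδ hE).mono ?_ subset_rfl
  rcases Nat.eq_zero_or_pos (meshCount d δ E) with h0 | h0
  · rw [h0, Nat.cast_zero]
    positivity
  · rw [div_lt_iff₀ (neg_pos.2 (Real.log_neg hδ h4))] at h1
    rw [← Real.log_le_log_iff (by exact_mod_cast h0) (by positivity), Real.log_rpow hδ]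
    linarith

/-- Cover of the part of an inhomogeneous attractor away from a set `E₁` that absorbs all
sufficiently small copies of the attractor. -/
lemma coveredBy_image_diff {d m : ℕ} {S : Fin m → (Fin d → ℝ) → (Fin d → ℝ)} {c : Fin m → ℝ}
    (hc : ∀ i, 0 < c i ∧ c i < 1)
    (hsim : ∀ i x y, euclDist d (S i x) (S i y) = c i * euclDist d x y)
    {C F₀ FC E₁ : Set (Fin d → ℝ)} (hS : ∀ i, Set.MapsTo (S i) F₀ F₀)
    (hFC : FC = (⋃ i, S i '' FC) ∪ C) {δ ρ b M B q : ℝ} (hδ : 0 < δ) (hρ : 0 < ρ) (hM : 0 ≤ M)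
    (hB : 0 ≤ B) (hP : δ ^ (-b) * ρ ^ (-M) ≤ B * (1 - ∑ i, c i ^ (b + M)))
    (hq : ∀ i, c i ≤ q)
    (hsmall : ∀ (f : (Fin d → ℝ) → (Fin d → ℝ)) (l : ℝ), 0 < l → l ≤ ρ →
      (∀ x y, euclDist d (f x) (f y) = l * euclDist d x y) → Set.MapsTo f F₀ F₀ → f '' FC ⊆ E₁)
    (hC : ∀ l, ρ < l → l ≤ 1 → CoveredBy d (δ / l) ((δ / l) ^ (-b)) C) (n : ℕ) :
    ∀ (f : (Fin d → ℝ) → (Fin d → ℝ)) (l : ℝ), 0 < l → l ≤ 1 →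
      (∀ x y, euclDist d (f x) (f y) = l * euclDist d x y) → Set.MapsTo f F₀ F₀ →
      l * q ^ n ≤ ρ → CoveredBy d (d * δ) (B * l ^ (b + M)) (f '' FC \ E₁) := by
  induction n with
  | zero =>
    intro f l hl hl1 hf hF hn
    rw [pow_zero, mul_one] at hn
    rw [Set.sdiff_eq_empty.2 (hsmall f l hl hn hf hF)]
    exact coveredBy_empty (by positivity)
  | succ n ih =>
    intro f l hl hl1 hf hF hn
    rcases le_or_gt l ρ with h | h
    · rw [Set.sdiff_eq_empty.2 (hsmall f l hl h hf hF)]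
      exact coveredBy_empty (by positivity)
    have hsub : f '' FC \ E₁ ⊆ (⋃ i, ((f ∘ S i) '' FC \ E₁)) ∪ f '' C := by
      rintro _ ⟨⟨x, hx, rfl⟩, hE⟩
      rw [hFC] at hx
      rcases hx with hx | hx
      · obtain ⟨i, y, hy, rfl⟩ := Set.mem_iUnion.1 hx
        exact Or.inl (Set.mem_iUnion.2 ⟨i, ⟨y, hy, rfl⟩, hE⟩)
      · exact Or.inr ⟨x, hx, rfl⟩
    have h1 : ∀ i, CoveredBy d (d * δ) (B * (l * c i) ^ (b + M)) ((f ∘ S i) '' FC \ E₁) := by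
      intro i
      refine ih (f ∘ S i) (l * c i) (mul_pos hl (hc i).1)
        (mul_le_one₀ hl1 (hc i).1.le (hc i).2.le) (fun x y => ?_) (hF.comp (hS i)) ?_
      · simp only [Function.comp, hf, hsim, mul_assoc]
      · have hq0 : 0 ≤ q := (hc i).1.le.trans (hq i)
        refine le_trans ?_ hn
        rw [pow_succ', mul_assoc]
        gcongr
        exact hq i
    have h2 := (hC l h hl1).image hl.le hf
    rw [mul_div_cancel₀ _ hl.ne'] at h2
    refine ((coveredBy_iUnion h1).union h2).mono ?_ hsub
    have e1 : ∑ i, B * (l * c i) ^ (b + M) = B * l ^ (b + M) * ∑ i, c i ^ (b + M) := by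
      rw [Finset.mul_sum]
      refine Finset.sum_congr rfl fun i _ => ?_
      rw [Real.mul_rpow hl.le (hc i).1.le, mul_assoc]
    have e2 : (δ / l) ^ (-b) ≤ B * (1 - ∑ i, c i ^ (b + M)) * l ^ (b + M) := by
      have e3 : 1 ≤ ρ ^ (-M) * l ^ M := by
        rw [Real.rpow_neg hρ.le, inv_mul_eq_div, one_le_div (by positivity)]
        exact Real.rpow_le_rpow hρ.le h.le hM
      calc (δ / l) ^ (-b) = δ ^ (-b) * l ^ b := by
            rw [Real.div_rpow hδ.le hl.le, Real.rpow_neg hl.le, div_inv_eq_mul]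
        _ ≤ δ ^ (-b) * l ^ b * (ρ ^ (-M) * l ^ M) := le_mul_of_one_le_right (by positivity) e3
        _ = δ ^ (-b) * ρ ^ (-M) * l ^ (b + M) := by rw [Real.rpow_add hl]; ring
        _ ≤ _ := by gcongr
    rw [e1]
    linarith

/-- Splitting an inhomogeneous self-similar set at the intermediate scale `δ ^ t`. -/
lemma exists_eventually_meshCount_le {d m : ℕ} (hm : 0 < m)
    {S : Fin m → (Fin d → ℝ) → (Fin d → ℝ)} {c : Fin m → ℝ}
    (hc : ∀ i, 0 < c i ∧ c i < 1)
    (hsim : ∀ i x y, euclDist d (S i x) (S i y) = c i * euclDist d x y)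
    {C F₀ FC : Set (Fin d → ℝ)} (hCcpt : IsCompact C)
    (hF₀ne : F₀.Nonempty) (hF₀cpt : IsCompact F₀) (hF₀ : F₀ = ⋃ i, S i '' F₀)
    (hFCcpt : IsCompact FC) (hFC : FC = (⋃ i, S i '' FC) ∪ C)
    {s a b t M γ : ℝ} (hs : ∑ i, c i ^ s = 1)
    (ha : upperBoxDim d F₀ < a) (hb : upperBoxDim d C < b) (ht0 : 0 < t) (ht1 : t < 1)
    (hM : 0 ≤ M) (hsM : s < b + M) (hγ₁ : b + t * M ≤ γ) (hγ₂ : t * a + (1 - t) * d ≤ γ) :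
    ∃ K : ℝ, ∀ᶠ δ in 𝓝[>] (0 : ℝ), (meshCount d δ FC : ℝ) ≤ K * δ ^ (-γ) := by
  have : Nonempty (Fin m) := ⟨⟨0, hm⟩⟩
  have hS : ∀ i, Set.MapsTo (S i) F₀ F₀ := fun i x hx => by
    rw [hF₀]
    exact Set.mem_iUnion.2 ⟨i, x, hx, rfl⟩
  have hP : ∑ i, c i ^ (b + M) < 1 := by
    rw [← hs]
    exact Finset.sum_lt_sum_of_nonempty Finset.univ_nonempty fun i _ =>
      Real.rpow_lt_rpow_of_exponent_gt (hc i).1 (hc i).2 hsM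
  obtain ⟨i₀, hi₀⟩ := Finite.exists_max c
  obtain ⟨z, hz⟩ := hF₀ne
  obtain ⟨R, hR⟩ : ∃ R : ℕ, ∀ x ∈ FC, euclDist d x z ≤ R := by
    obtain ⟨r, hr⟩ := hFCcpt.isBounded.subset_closedBall z
    obtain ⟨R, hR⟩ := exists_nat_ge (d * r)
    refine ⟨R, fun x hx => (euclDist_le_mul_dist d x z).trans (le_trans ?_ hR)⟩
    have := Metric.mem_closedBall.1 (hr hx)
    gcongr
  have hrpow : ∀ u : ℝ, 0 < u → Tendsto (fun δ : ℝ => δ ^ u) (𝓝[>] 0) (𝓝[>] 0) := by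
    intro u hu
    refine tendsto_nhdsWithin_iff.2 ⟨?_, ?_⟩
    · have := (Real.continuousAt_rpow_const 0 u (Or.inr hu.le)).tendsto.mono_left
        (nhdsWithin_le_nhds (s := Set.Ioi 0))
      rwa [Real.zero_rpow hu.ne'] at this
    · filter_upwards [self_mem_nhdsWithin] with δ hδ
      exact Real.rpow_pos_of_pos hδ u
  obtain ⟨r₀, hr₀, hr₀C⟩ := mem_nhdsGT_iff_exists_Ioo_subset.1
    (eventually_coveredBy_of_upperBoxDim_lt hCcpt.isBounded hb)
  refine ⟨(2 * (R + 1 : ℕ) + 5) ^ d + (1 - ∑ i, c i ^ (b + M))⁻¹ * (2 * d + 3) ^ d, ?_⟩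
  filter_upwards [(hrpow t ht0).eventually
      (eventually_coveredBy_of_upperBoxDim_lt hF₀cpt.isBounded ha),
    (hrpow (1 - t) (by linarith)).eventually (Ioo_mem_nhdsGT hr₀),
    self_mem_nhdsWithin, nhdsWithin_le_nhds (gt_mem_nhds one_pos)] with δ hcov hδr hδ0 hδ1
  have hδ : (0 : ℝ) < δ := hδ0
  set ρ := δ ^ t with hρdef
  have hρ : 0 < ρ := by positivity
  have hδρ : δ ≤ ρ := by
    simpa using Real.rpow_le_rpow_of_exponent_ge hδ hδ1.le ht1.le
  set E₁ : Set (Fin d → ℝ) := {y | ∃ w ∈ F₀, dist y w ≤ R * ρ} with hE₁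
  have hnear : CoveredBy d ((R + 1 : ℕ) * ρ) (ρ ^ (-a)) (FC ∩ E₁) := by
    obtain ⟨Q, hQ, hQc⟩ := hcov
    refine ⟨Q, hQ, ?_⟩
    rintro y ⟨-, w, hw, hyw⟩
    obtain ⟨x, hx, hwx⟩ := hQc w hw
    refine ⟨x, hx, (dist_triangle y w x).trans ?_⟩
    push_cast
    linarith
  obtain ⟨n, hn⟩ := exists_pow_lt_of_lt_one hρ (hc i₀).2
  have hB : 0 ≤ δ ^ (-b) * ρ ^ (-M) * (1 - ∑ i, c i ^ (b + M))⁻¹ := by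
    have := sub_pos.2 hP
    positivity
  have hfar : CoveredBy d (d * δ) (δ ^ (-b) * ρ ^ (-M) * (1 - ∑ i, c i ^ (b + M))⁻¹)
      (FC \ E₁) := by
    have := coveredBy_image_diff hc hsim hS hFC (E₁ := E₁) hδ hρ hM hB
      (by rw [inv_mul_cancel_right₀ (sub_pos.2 hP).ne']) hi₀ ?_ ?_ n id 1 one_pos le_rfl
      (by simp) (Set.mapsTo_id _) (by simpa using hn.le)
    · simpa using this
    · rintro f l hl hlρ hf hF _ ⟨x, hx, rfl⟩
      refine ⟨f z, hF hz, (dist_le_euclDist _ _ _).trans ?_⟩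
      rw [hf, mul_comm]
      have := hR x hx
      gcongr
    · intro l hl hl1
      have hl0 := hρ.trans hl
      refine hr₀C ⟨by positivity, lt_of_lt_of_le ?_ hδr.2.le⟩
      rw [Real.rpow_sub hδ, Real.rpow_one]
      gcongr
  have h1 := hnear.meshCount_le_of_le hδ hδρ (by positivity)
  have h2 := hfar.meshCount_le hδ
  have h3 := meshCount_union_le d hδ (FC ∩ E₁) (FC \ E₁)
  rw [Set.inter_union_sdiff] at h3
  have g1 : ρ ^ (-a) * (ρ / δ) ^ d ≤ δ ^ (-γ) := by
    rw [hρdef, div_eq_mul_inv, ← Real.rpow_neg_one δ, ← Real.rpow_add hδ, ← Real.rpow_natCast,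
      ← Real.rpow_mul hδ.le, ← Real.rpow_mul hδ.le, ← Real.rpow_add hδ]
    exact Real.rpow_le_rpow_of_exponent_ge hδ hδ1.le (by linarith)
  have g2 : δ ^ (-b) * ρ ^ (-M) ≤ δ ^ (-γ) := by
    rw [hρdef, ← Real.rpow_mul hδ.le, ← Real.rpow_add hδ]
    exact Real.rpow_le_rpow_of_exponent_ge hδ hδ1.le (by linarith)
  have hP' : 0 < (1 - ∑ i, c i ^ (b + M))⁻¹ := inv_pos.2 (sub_pos.2 hP)
  calc (meshCount d δ FC : ℝ)
      ≤ meshCount d δ (FC ∩ E₁) + meshCount d δ (FC \ E₁) := by exact_mod_cast h3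
    _ ≤ _ := add_le_add h1 h2
    _ = (2 * (R + 1 : ℕ) + 5) ^ d * (ρ ^ (-a) * (ρ / δ) ^ d) +
        (1 - ∑ i, c i ^ (b + M))⁻¹ * (2 * d + 3) ^ d * (δ ^ (-b) * ρ ^ (-M)) := by
      rw [mul_pow]; ring
    _ ≤ (2 * (R + 1 : ℕ) + 5) ^ d * δ ^ (-γ) +
        (1 - ∑ i, c i ^ (b + M))⁻¹ * (2 * d + 3) ^ d * δ ^ (-γ) := by gcongr
    _ = _ := by ring

/-- Corollary 5.9: for an inhomogeneous self-similar set `F_C ⊆ ℝ^d` with similarity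
dimension `s`, `α = dim_B F_∅` and `β = upper box dimension of C`:
if `max(α,β) < s` then `dim_B F_C < s`, and if `max(α,β) < d` then `dim_B F_C < d`. -/
theorem dimension_strict_bounds (d m : ℕ) (hm : 0 < m)
    (S : Fin m → (Fin d → ℝ) → (Fin d → ℝ)) (c : Fin m → ℝ)
    (hc : ∀ i, 0 < c i ∧ c i < 1)
    (hsim : ∀ i x y, euclDist d (S i x) (S i y) = c i * euclDist d x y)
    (C F₀ FC : Set (Fin d → ℝ)) (hCcpt : IsCompact C)
    (hF₀ne : F₀.Nonempty) (hF₀cpt : IsCompact F₀) (hF₀ : F₀ = ⋃ i, S i '' F₀)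
    (hFCne : FC.Nonempty) (hFCcpt : IsCompact FC) (hFC : FC = (⋃ i, S i '' FC) ∪ C)
    (s α β : ℝ)
    (hs0 : 0 ≤ s) (hs : ∑ i, c i ^ s = 1)
    (hα : α = upperBoxDim d F₀) (hβ : β = upperBoxDim d C) :
    (max α β < s → upperBoxDim d FC < s) ∧
    (max α β < d → upperBoxDim d FC < d) := by
  have hα0 : 0 ≤ α := hα ▸ upperBoxDim_nonneg hF₀cpt.isBounded
  have key := fun {a b t M γ : ℝ} => exists_eventually_meshCount_le (a := a) (b := b) (t := t)
    (M := M) (γ := γ) hm hc hsim hCcpt hF₀ne hF₀cpt hF₀ hFCcpt hFC hs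
  refine ⟨fun h => ?_, fun h => ?_⟩
  · obtain ⟨a, ha, has⟩ := exists_between ((le_max_left α β).trans_lt h)
    obtain ⟨b, hb, hbs⟩ := exists_between ((le_max_right α β).trans_lt h)
    obtain ⟨t, ht, ht0, ht1⟩ : ∃ t : ℝ, t * a + (1 - t) * d < s ∧ 0 < t ∧ t < 1 := by
      have hcont : Tendsto (fun t : ℝ => t * a + (1 - t) * d) (𝓝[<] 1) (𝓝 a) := by
        have : Continuous fun t : ℝ => t * a + (1 - t) * d := by fun_prop
        simpa using (this.tendsto 1).mono_left (nhdsWithin_le_nhds (s := Set.Iio 1))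
      exact ((hcont.eventually (gt_mem_nhds has)).and (Ioo_mem_nhdsLT one_pos)).exists
    obtain ⟨M, hM, hM'⟩ : ∃ M, s - b < M ∧ M < (s - b) / t :=
      exists_between ((lt_div_iff₀ ht0).2 (mul_lt_of_lt_one_right (sub_pos.2 hbs) ht1))
    rw [lt_div_iff₀ ht0] at hM'
    obtain ⟨K, hK⟩ := key (hα ▸ ha) (hβ ▸ hb) ht0 ht1 (by linarith) (by linarith)
      (le_max_left (b + t * M) (t * a + (1 - t) * d)) (le_max_right _ _)
    exact upperBoxDim_lt (max_lt (by linarith) ht)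
      (hα0.trans_lt ((le_max_left α β).trans_lt h)) hK
  · obtain ⟨a, ha, had⟩ := exists_between ((le_max_left α β).trans_lt h)
    obtain ⟨b, hb, hbd⟩ := exists_between ((le_max_right α β).trans_lt h)
    obtain ⟨M, hM⟩ := exists_gt (max 0 (s - b))
    obtain ⟨hM0, hMs⟩ := max_lt_iff.1 hM
    obtain ⟨t, ht, ht0, ht1⟩ : ∃ t : ℝ, b + t * M < d ∧ 0 < t ∧ t < 1 := by
      have hcont : Tendsto (fun t : ℝ => b + t * M) (𝓝[>] 0) (𝓝 b) := by
        have : Continuous fun t : ℝ => b + t * M := by fun_prop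
        simpa using (this.tendsto 0).mono_left (nhdsWithin_le_nhds (s := Set.Ioi 0))
      exact ((hcont.eventually (gt_mem_nhds hbd)).and (Ioo_mem_nhdsGT one_pos)).exists
    obtain ⟨K, hK⟩ := key (hα ▸ ha) (hβ ▸ hb) ht0 ht1 hM0.le (by linarith)
      (le_max_left (b + t * M) (t * a + (1 - t) * d)) (le_max_right _ _)
    exact upperBoxDim_lt (max_lt ht (by nlinarith))
      (hα0.trans_lt ((le_max_left α β).trans_lt h)) hK
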